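/- Let X be Borel distributed with parameter μ ∈ (0,1). Then the third cumulant of X, which equals the third central moment E[(X − E[X])³], is given by κ_X^{(3)} = μ(1 + 2μ)/(1−μ)⁵. -/

import Mathlib

open Real Set Filter Topology

/-- The coefficients `(n + 1) ^ n / (n + 1)!` of the rooted tree function. -/
noncomputable def treeCoeff (n : ℕ) : ℝ := ((n : ℝ) + 1) ^ n / (n + 1).factorial

/-- The series `∑ N ≥ 1, N ^ k * N ^ (N - 1) / N! * x ^ N`. -/
noncomputable def treeSeries (k : ℕ) (x : ℝ) : ℝ :=
  ∑' n : ℕ, ((n : ℝ) + 1) ^ k * treeCoeff n * x ^ (n + 1)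

lemma treeCoeff_nonneg (n : ℕ) : 0 ≤ treeCoeff n := by
  unfold treeCoeff; positivity

lemma treeCoeff_le (n : ℕ) : treeCoeff n ≤ exp 1 ^ (n + 1) := by
  have h := pow_div_factorial_le_exp (x := (n : ℝ) + 1) (by positivity) (n + 1)
  have h1 : ((n : ℝ) + 1) ^ n ≤ ((n : ℝ) + 1) ^ (n + 1) :=
    pow_le_pow_right₀ (by linarith [n.cast_nonneg (α := ℝ)]) n.le_succ
  calc treeCoeff n ≤ ((n : ℝ) + 1) ^ (n + 1) / (n + 1).factorial := by
        unfold treeCoeff; gcongr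
    _ ≤ exp ((n : ℝ) + 1) := h
    _ = exp 1 ^ (n + 1) := by rw [← exp_nat_mul]; push_cast; simp

lemma exp_one_mul_lt_one {x : ℝ} (hx : x < exp (-1)) : exp 1 * x < 1 := by
  calc exp 1 * x < exp 1 * exp (-1) := by gcongr
    _ = 1 := by rw [← exp_add]; simp

lemma summable_treeSeries_of_nonneg (k : ℕ) {x : ℝ} (hx0 : 0 ≤ x) (hx : x < exp (-1)) :
    Summable fun n : ℕ ↦ ((n : ℝ) + 1) ^ k * treeCoeff n * x ^ (n + 1) := by
  have hq : ‖exp 1 * x‖ < 1 := by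
    rw [norm_of_nonneg (by positivity)]; exact exp_one_mul_lt_one hx
  have hs : Summable fun n : ℕ ↦ ((n + 1 : ℕ) : ℝ) ^ k * (exp 1 * x) ^ (n + 1) :=
    (summable_nat_add_iff (f := fun n : ℕ ↦ (n : ℝ) ^ k * (exp 1 * x) ^ n) 1).2
      (summable_pow_mul_geometric_of_norm_lt_one k hq)
  refine Summable.of_nonneg_of_le (fun n ↦ ?_) (fun n ↦ ?_) hs
  · have := treeCoeff_nonneg n; positivity
  · rw [mul_pow, ← mul_assoc]
    push_cast
    gcongr
    exact treeCoeff_le n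

lemma hasDerivAt_treeSeries (k : ℕ) {x : ℝ} (hx0 : 0 < x) (hx : x < exp (-1)) :
    HasDerivAt (treeSeries k) (treeSeries (k + 1) x / x) x := by
  obtain ⟨r, hxr, hr⟩ := exists_between hx
  have hr0 : 0 < r := hx0.trans hxr
  have hu : Summable fun n : ℕ ↦ ((n : ℝ) + 1) ^ (k + 1) * treeCoeff n * r ^ n := by
    refine ((summable_treeSeries_of_nonneg (k + 1) hr0.le hr).mul_right r⁻¹).congr fun n ↦ ?_
    field_simp
    ring
  have h := hasDerivAt_tsum_of_isPreconnected hu (t := Ioo 0 r) isOpen_Ioo isPreconnected_Ioo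
    (g := fun (n : ℕ) y ↦ ((n : ℝ) + 1) ^ k * treeCoeff n * y ^ (n + 1))
    (g' := fun (n : ℕ) y ↦ ((n : ℝ) + 1) ^ (k + 1) * treeCoeff n * y ^ n) (y₀ := x) (y := x)
    (fun n y _ ↦ ?_) (fun n y hy ↦ ?_) ⟨hx0, hxr⟩ (summable_treeSeries_of_nonneg k hx0.le hx)
    ⟨hx0, hxr⟩
  · convert! h using 1
    rw [treeSeries, ← tsum_div_const]
    refine tsum_congr fun n ↦ ?_
    field_simp
    ring
  · convert! (hasDerivAt_pow (n + 1) y).const_mul (((n : ℝ) + 1) ^ k * treeCoeff n) using 1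
    push_cast
    ring
  · have := treeCoeff_nonneg n
    have := hy.1
    rw [norm_of_nonneg (by positivity)]
    gcongr
    exact hy.2.le

lemma analyticAt_treeSeries_zero {x : ℝ} (hx0 : 0 < x) (hx : x < exp (-1)) :
    AnalyticAt ℝ (treeSeries 0) x := by
  obtain ⟨r, hxr, hr⟩ := exists_between hx
  have hr0 : 0 < r := hx0.trans hxr
  lift r to NNReal using hr0.le
  have hs : Summable fun n : ℕ ↦ ‖FormalMultilinearSeries.ofScalars ℝ treeCoeff n‖ * (r : ℝ) ^ n := by
    refine ((summable_treeSeries_of_nonneg 0 hr0.le hr).mul_right (r : ℝ)⁻¹).congr fun n ↦ ?_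
    rw [FormalMultilinearSeries.ofScalars_norm, norm_of_nonneg (treeCoeff_nonneg n)]
    field_simp
    ring
  have hrad := FormalMultilinearSeries.le_radius_of_summable _ hs
  have hx_mem : x ∈ Metric.eball (0 : ℝ) (FormalMultilinearSeries.ofScalars ℝ treeCoeff).radius := by
    refine Metric.eball_subset_eball hrad ?_
    rw [Metric.eball_coe, Metric.mem_ball, dist_zero_right, norm_of_nonneg hx0.le]
    exact hxr
  have ha := (FormalMultilinearSeries.hasFPowerSeriesOnBall _
    (lt_of_lt_of_le (by exact_mod_cast hr0) hrad)).analyticAt_of_mem hx_mem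
  convert! analyticAt_id.mul ha using 1
  ext y
  change _ = y * FormalMultilinearSeries.ofScalarsSum treeCoeff y
  rw [FormalMultilinearSeries.ofScalarsSum_eq_tsum, treeSeries, ← tsum_mul_left]
  refine tsum_congr fun n ↦ ?_
  rw [smul_eq_mul]
  ring

lemma mul_exp_neg_lt {μ : ℝ} (h1 : μ < 1) : μ * exp (-μ) < exp (-1) := by
  have h := add_one_lt_exp (x := μ - 1) (by linarith)
  calc μ * exp (-μ) < exp (μ - 1) * exp (-μ) := by gcongr; linarith
    _ = exp (-1) := by rw [← exp_add]; ring_nf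

/-- The alternating sum computing the coefficient of `μ ^ (m + 1)` in `T (μ * exp (-μ))`, where
`T` is the rooted tree function. -/
lemma sum_antidiagonal_treeCoeff (m : ℕ) :
    ∑ p ∈ Finset.HasAntidiagonal.antidiagonal m,
      treeCoeff p.1 * ((-((p.1 : ℝ) + 1)) ^ p.2 / p.2.factorial) = if m = 0 then 1 else 0 := by
  rcases Nat.eq_zero_or_pos m with rfl | hm
  · simp [treeCoeff]
  have h := congrFun (fwdDiff_iter_pow_eq_zero_of_lt (R := ℝ) m.lt_succ_self) 0
  rw [fwdDiff_iter_eq_sum_shift, Finset.sum_range_succ'] at h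
  simp only [Nat.succ_eq_add_one, Nat.reduceSubDiff, zero_add, nsmul_eq_mul, mul_one,
    zero_pow hm.ne', smul_zero, add_zero, Pi.zero_apply, zsmul_eq_mul,
    zero_smul] at h
  rw [if_neg hm.ne', Finset.Nat.sum_antidiagonal_eq_sum_range_succ_mk]
  have hf : ((m + 1).factorial : ℝ) ≠ 0 := by positivity
  refine (mul_right_injective₀ hf) ?_
  simp only [mul_zero]
  rw [← h, Finset.mul_sum]
  refine Finset.sum_congr rfl fun n hn ↦ ?_
  have hnm : n ≤ m := Nat.lt_succ_iff.1 (Finset.mem_range.1 hn)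
  have hc : ((m + 1).choose (n + 1) : ℝ) * (n + 1).factorial * (m - n).factorial
      = (m + 1).factorial := by
    have := Nat.choose_mul_factorial_mul_factorial (Nat.succ_le_succ hnm)
    rw [Nat.succ_sub_succ] at this
    exact_mod_cast this
  have hp : ((n : ℝ) + 1) ^ m = ((n : ℝ) + 1) ^ n * ((n : ℝ) + 1) ^ (m - n) := by
    rw [← pow_add, Nat.add_sub_cancel' hnm]
  push_cast
  rw [← hc, hp, neg_pow, treeCoeff]
  field_simp

lemma treeSeries_zero_of_small {μ : ℝ} (h0 : 0 < μ) (h : μ * exp μ < exp (-1)) :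
    treeSeries 0 (μ * exp (-μ)) = μ := by
  let F : ℕ × ℕ → ℝ := fun p ↦
    treeCoeff p.1 * μ ^ (p.1 + 1) * ((-((p.1 : ℝ) + 1) * μ) ^ p.2 / p.2.factorial)
  have hrow (n : ℕ) (y : ℝ) : HasSum
      (fun j : ℕ ↦ treeCoeff n * μ ^ (n + 1) * ((((n : ℝ) + 1) * y) ^ j / j.factorial))
      (treeCoeff n * (μ * exp y) ^ (n + 1)) := by
    have := (NormedSpace.expSeries_div_hasSum_exp (((n : ℝ) + 1) * y)).mul_left
      (treeCoeff n * μ ^ (n + 1))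
    rw [← Real.exp_eq_exp_ℝ] at this
    convert! this using 1
    rw [mul_pow, ← exp_nat_mul, mul_assoc]
    push_cast
    rfl
  have hnorm (p : ℕ × ℕ) : ‖F p‖ =
      treeCoeff p.1 * μ ^ (p.1 + 1) * ((((p.1 : ℝ) + 1) * μ) ^ p.2 / p.2.factorial) := by
    have := treeCoeff_nonneg p.1
    simp only [F, norm_mul, norm_div, norm_pow, norm_neg]
    rw [norm_of_nonneg this, norm_of_nonneg h0.le, norm_of_nonneg (by positivity),
      norm_of_nonneg (Nat.cast_nonneg _)]
  have hF : Summable F := by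
    refine Summable.of_norm ((summable_prod_of_nonneg fun p ↦ norm_nonneg _).2 ⟨fun n ↦ ?_, ?_⟩)
    · simp only [hnorm]
      exact (hrow n μ).summable
    · simp only [hnorm, (hrow _ μ).tsum_eq]
      simpa using summable_treeSeries_of_nonneg 0 (by positivity) h
  have hdiag (m : ℕ) : ∑ p ∈ Finset.HasAntidiagonal.antidiagonal m, F p = if m = 0 then μ else 0 := by
    have hm : ∑ p ∈ Finset.HasAntidiagonal.antidiagonal m, F p = μ ^ (m + 1) *
        ∑ p ∈ Finset.HasAntidiagonal.antidiagonal m,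
          treeCoeff p.1 * ((-((p.1 : ℝ) + 1)) ^ p.2 / p.2.factorial) := by
      rw [Finset.mul_sum]
      refine Finset.sum_congr rfl fun p hp ↦ ?_
      rw [← Finset.HasAntidiagonal.mem_antidiagonal.1 hp]
      simp only [F, mul_pow]
      ring
    rw [hm, sum_antidiagonal_treeCoeff]
    split_ifs with h
    · simp [h]
    · simp
  have hrows : treeSeries 0 (μ * exp (-μ)) = ∑' p, F p := by
    rw [hF.tsum_prod, treeSeries]
    refine tsum_congr fun n ↦ ?_
    have := (hrow n (-μ)).tsum_eq
    simp only [F, pow_zero, one_mul, neg_mul, mul_neg] at this ⊢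
    exact this.symm
  have hsigma : HasSum (fun c : Σ m : ℕ, Finset.HasAntidiagonal.antidiagonal m ↦ F c.2)
      (∑' p, F p) :=
    Finset.HasAntidiagonal.sigmaAntidiagonalEquivProd.hasSum_iff.2 hF.hasSum
  have hsum := hsigma.sigma fun m ↦ hasSum_fintype _
  simp only [Finset.sum_coe_sort _ F, hdiag] at hsum
  rw [hrows, ← hsum.tsum_eq, tsum_ite_eq]

lemma treeSeries_zero_mul_exp_neg {μ : ℝ} (h0 : 0 < μ) (h1 : μ < 1) :
    treeSeries 0 (μ * exp (-μ)) = μ := by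
  have hf : AnalyticOnNhd ℝ (fun t : ℝ ↦ treeSeries 0 (t * exp (-t))) (Ioo 0 1) := fun t ht ↦
    (analyticAt_treeSeries_zero (mul_pos ht.1 (exp_pos _)) (mul_exp_neg_lt ht.2)).fun_comp
      (f := fun t : ℝ ↦ t * exp (-t)) (by fun_prop)
  have hmem : ∀ᶠ t : ℝ in 𝓝[>] 0, t * exp t < exp (-1) ∧ t ∈ Ioo (0 : ℝ) 1 := by
    refine .and (nhdsWithin_le_nhds ?_) (Ioo_mem_nhdsGT one_pos)
    exact (Continuous.tendsto (by fun_prop : Continuous fun t : ℝ ↦ t * exp t) 0).eventually_lt_const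
      (by simpa using exp_pos (-1))
  obtain ⟨z, hz, hz01⟩ := hmem.exists
  refine hf.eqOn_of_preconnected_of_eventuallyEq (g := id) analyticOnNhd_id isPreconnected_Ioo hz01
    ?_ ⟨h0, h1⟩
  have hc : ∀ᶠ t : ℝ in 𝓝 z, t * exp t < exp (-1) :=
    (Continuous.tendsto (by fun_prop : Continuous fun t : ℝ ↦ t * exp t) z).eventually_lt_const hz
  filter_upwards [hc, Ioi_mem_nhds hz01.1] with t ht ht0 using treeSeries_zero_of_small ht0 ht

/-- If `μ ↦ treeSeries k (μ * exp (-μ))` is known on `(0, 1)`, then so is its successor. -/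
lemma treeSeries_succ_mul_exp_neg {k : ℕ} {f : ℝ → ℝ} {f' μ : ℝ}
    (hf : ∀ t ∈ Ioo (0 : ℝ) 1, treeSeries k (t * exp (-t)) = f t)
    (h0 : 0 < μ) (h1 : μ < 1) (hf' : HasDerivAt f f' μ) :
    treeSeries (k + 1) (μ * exp (-μ)) = μ / (1 - μ) * f' := by
  have hin : HasDerivAt (fun t : ℝ ↦ t * exp (-t)) ((1 - μ) * exp (-μ)) μ := by
    convert! (hasDerivAt_id μ).mul (hasDerivAt_neg μ).exp using 1
    simp only [id]
    ring
  have hcomp := (hasDerivAt_treeSeries k (mul_pos h0 (exp_pos _)) (mul_exp_neg_lt h1)).comp μ hin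
  have heq : f =ᶠ[𝓝 μ] treeSeries k ∘ fun t ↦ t * exp (-t) := by
    filter_upwards [Ioo_mem_nhds h0 h1] with t ht using (hf t ht).symm
  rw [hf'.unique (hcomp.congr_of_eventuallyEq heq)]
  have : 1 - μ ≠ 0 := by linarith
  field_simp

lemma treeSeries_one_mul_exp_neg {μ : ℝ} (h0 : 0 < μ) (h1 : μ < 1) :
    treeSeries 1 (μ * exp (-μ)) = μ / (1 - μ) := by
  simpa using treeSeries_succ_mul_exp_neg (f := id)
    (fun t ht ↦ treeSeries_zero_mul_exp_neg ht.1 ht.2) h0 h1 (hasDerivAt_id μ)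

lemma treeSeries_two_mul_exp_neg {μ : ℝ} (h0 : 0 < μ) (h1 : μ < 1) :
    treeSeries 2 (μ * exp (-μ)) = μ / (1 - μ) ^ 3 := by
  have hne : 1 - μ ≠ 0 := by linarith
  rw [treeSeries_succ_mul_exp_neg (fun t ht ↦ treeSeries_one_mul_exp_neg ht.1 ht.2) h0 h1
    ((hasDerivAt_id' μ).fun_div ((hasDerivAt_id' μ).const_sub 1) hne)]
  field_simp
  ring

lemma treeSeries_three_mul_exp_neg {μ : ℝ} (h0 : 0 < μ) (h1 : μ < 1) :
    treeSeries 3 (μ * exp (-μ)) = μ * (1 + 2 * μ) / (1 - μ) ^ 5 := by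
  have hne : 1 - μ ≠ 0 := by linarith
  rw [treeSeries_succ_mul_exp_neg (fun t ht ↦ treeSeries_two_mul_exp_neg ht.1 ht.2) h0 h1
    ((hasDerivAt_id' μ).fun_div (((hasDerivAt_id' μ).const_sub 1).fun_pow 3) (pow_ne_zero 3 hne))]
  field_simp
  push_cast
  ring

/-- The moments of the Borel distribution in terms of `treeSeries`. -/
lemma hasSum_borel_moment (k : ℕ) {μ : ℝ} (h0 : 0 < μ) (h1 : μ < 1) :
    HasSum (fun n : ℕ ↦ ((n : ℝ) + 1) ^ k *
      (exp (-μ * (n + 1)) * (μ * (n + 1)) ^ n / (n + 1).factorial))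
      (treeSeries k (μ * exp (-μ)) / μ) := by
  convert! (summable_treeSeries_of_nonneg k (mul_pos h0 (exp_pos _)).le
    (mul_exp_neg_lt h1)).hasSum.div_const μ using 2 with n
  have he : exp (-μ * (n + 1)) = exp (-μ) ^ (n + 1) := by
    rw [← exp_nat_mul]; push_cast; ring_nf
  rw [he, treeCoeff, mul_pow, mul_pow]
  field_simp
  ring


/-- For a Borel distributed random variable `X` with parameter `μ ∈ (0,1)`, the third
cumulant, which equals the third central moment `E[(X - E[X])³]`, is
`κ_X^{(3)} = μ(1 + 2μ)/(1-μ)⁵`. -/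
theorem borel_third_cumulant (μ : ℝ) (hμ0 : 0 < μ) (hμ1 : μ < 1)
    (m : ℝ)
    (hm : m = ∑' n : ℕ, ((n : ℝ) + 1) *
      (Real.exp (-μ * (n + 1)) * (μ * (n + 1)) ^ n / (n + 1).factorial)) :
    ∑' n : ℕ, ((n : ℝ) + 1 - m) ^ 3 *
      (Real.exp (-μ * (n + 1)) * (μ * (n + 1)) ^ n / (n + 1).factorial)
      = μ * (1 + 2 * μ) / (1 - μ) ^ 5 := by
  have hne : 1 - μ ≠ 0 := by linarith
  have hμ : μ ≠ 0 := hμ0.ne'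
  have s0 := hasSum_borel_moment 0 hμ0 hμ1
  have s1 := hasSum_borel_moment 1 hμ0 hμ1
  have s2 := hasSum_borel_moment 2 hμ0 hμ1
  have s3 := hasSum_borel_moment 3 hμ0 hμ1
  rw [treeSeries_zero_mul_exp_neg hμ0 hμ1] at s0
  rw [treeSeries_one_mul_exp_neg hμ0 hμ1] at s1
  rw [treeSeries_two_mul_exp_neg hμ0 hμ1] at s2
  rw [treeSeries_three_mul_exp_neg hμ0 hμ1] at s3
  have hm' : m = 1 / (1 - μ) := by
    simp only [pow_one] at s1
    rw [hm, s1.tsum_eq]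
    field_simp
  have h := ((s3.sub (s2.mul_left (3 * m))).add (s1.mul_left (3 * m ^ 2))).sub
    (s0.mul_left (m ^ 3))
  refine (tsum_congr fun n ↦ ?_).trans (h.tsum_eq.trans ?_)
  · ring
  · rw [hm']
    field_simp
    ring
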